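/- Let the columns of U₁ ∈ ℝ^{M₁×r} and U₂ ∈ ℝ^{M₁×r} be orthonormal bases of two independently drawn random r-dimensional subspaces of ℝ^{M₁}, each distributed uniformly at random (with respect to the rotation-invariant Haar distribution on r-dimensional subspaces). Then for every δ ∈ (0,1), P[ ‖U₁ᵀU₂‖ > √(c_δ r²/M₁) ] ≤ δ, where √c_δ = 3·max( 1, √(8 M₁ π/((M₁−1)r)), √(8 M₁ log(r/δ)/((M₁−1)r)) ) and ‖·‖ denotes the spectral norm. -/

import Mathlib

open Matrix Finset MeasureTheory ProbabilityTheory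

noncomputable section

namespace Paper

instance {m n α : Type*} [MeasurableSpace α] : MeasurableSpace (Matrix m n α) :=
  MeasurableSpace.pi

/-- Euclidean (`ℓ₂`) norm of a vector. -/
def enorm {ι : Type*} [Fintype ι] (v : ι → ℝ) : ℝ := Real.sqrt (∑ i, v i ^ 2)

/-- `ℓ_p` norm of a vector. -/
def pnorm {ι : Type*} [Fintype ι] (p : ℝ) (v : ι → ℝ) : ℝ := (∑ i, |v i| ^ p) ^ (1 / p)

/-- Spectral norm (largest singular value) of a real matrix. -/
def spec {a b : Type*} [Fintype a] [Fintype b] (M : Matrix a b ℝ) : ℝ :=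
  ⨆ v : { v : b → ℝ // enorm v = 1 }, enorm (M.mulVec v.1)

/-- Smallest singular value of a real matrix. -/
def smin {a b : Type*} [Fintype a] [Fintype b] (M : Matrix a b ℝ) : ℝ :=
  ⨅ v : { v : b → ℝ // enorm v = 1 }, enorm (M.mulVec v.1)

/-- Column space (span of the columns) of a matrix. -/
def colSpan {a b : Type*} (M : Matrix a b ℝ) : Submodule ℝ (a → ℝ) :=
  Submodule.span ℝ (Set.range Mᵀ)

/-- Requirement 1 with parameters `κ` and `p`; the columns of the data matrix are indexed by
`Fin m × Fin n`, the first coordinate being the cluster index. -/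
def Req1 {m n : ℕ} (A : Matrix (Fin m × Fin n) (Fin m × Fin n) ℝ) (κ p : ℝ) : Prop :=
  ∀ i : Fin m × Fin n,
    κ / ((m : ℝ) - 1) * ∑ j ∈ univ.filter (fun j : Fin m × Fin n => j.1 ≠ i.1), |A j i| ^ p
      < ∑ j ∈ univ.filter (fun j : Fin m × Fin n => j.1 = i.1), |A j i| ^ p

/-- Feasibility for the direction-search problem: `cᵢᵀ dᵢ = 1` for every column. -/
def Feasible {a ι : Type*} [Fintype a] [Fintype ι] (D C : Matrix a ι ℝ) : Prop :=
  ∀ i, dotProduct (Cᵀ i) (Dᵀ i) = 1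

/-- Optimal point of `min_C ∑ᵢ ‖Dᵀ cᵢ‖_p  s.t.  cᵢᵀ dᵢ = 1`. -/
def IsOptimal {a ι : Type*} [Fintype a] [Fintype ι] (p : ℝ) (D C : Matrix a ι ℝ) : Prop :=
  Feasible D C ∧ ∀ C' : Matrix a ι ℝ, Feasible D C' →
    ∑ i, pnorm p (Dᵀ.mulVec (Cᵀ i)) ≤ ∑ i, pnorm p (Dᵀ.mulVec (C'ᵀ i))

/-- Optimal point of `min_C ∑ᵢ ‖Dᵀ cᵢ‖₂  s.t.  cᵢᵀ dᵢ = 1`. -/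
def IsOptimal2 {a ι : Type*} [Fintype a] [Fintype ι] (D C : Matrix a ι ℝ) : Prop :=
  Feasible D C ∧ ∀ C' : Matrix a ι ℝ, Feasible D C' →
    ∑ i, enorm (Dᵀ.mulVec (Cᵀ i)) ≤ ∑ i, enorm (Dᵀ.mulVec (C'ᵀ i))

/-- The adjacency matrix `A = |Dᵀ C|`. -/
def adjacency {a ι : Type*} [Fintype a] [Fintype ι] (D C : Matrix a ι ℝ) : Matrix ι ι ℝ :=
  Matrix.of fun j i => |(Dᵀ * C) j i|

/-- `Δ_min`: the permeance statistic of the clusters. -/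
def Dmin {M₁ m n s rs : ℕ} (D : Matrix (Fin M₁) (Fin m × Fin n) ℝ)
    (Smat : Matrix (Fin M₁) (Fin s) ℝ) (Ud : Fin m → Matrix (Fin M₁) (Fin rs) ℝ)
    (p : ℝ) : ℝ :=
  ⨅ j : Fin m, ⨅ u : { u : Fin M₁ → ℝ // u ∈ colSpan Smat ⊔ colSpan (Ud j) ∧ enorm u = 1 },
    ∑ t : Fin n, |dotProduct u.1 (Dᵀ (j, t))| ^ p

/-- `Δ̇_max`. -/
def Ddotmax {M₁ m n rs : ℕ} (D : Matrix (Fin M₁) (Fin m × Fin n) ℝ)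
    (Ud : Fin m → Matrix (Fin M₁) (Fin rs) ℝ) (p : ℝ) : ℝ :=
  ⨆ j : Fin m, ⨆ u : { u : Fin rs → ℝ // enorm u = 1 },
    ∑ t : Fin n, |dotProduct u.1 ((Ud j)ᵀ.mulVec (Dᵀ (j, t)))| ^ p

/-- `Δ̄_max`. -/
def Dbarmax {M₁ m n s : ℕ} (D : Matrix (Fin M₁) (Fin m × Fin n) ℝ)
    (Smat : Matrix (Fin M₁) (Fin s) ℝ) (p : ℝ) : ℝ :=
  ⨆ j : Fin m, ⨆ u : { u : Fin s → ℝ // enorm u = 1 },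
    ∑ t : Fin n, |dotProduct u.1 (Smatᵀ.mulVec (Dᵀ (j, t)))| ^ p

/-- `φ = max_{j ≠ t} ‖U̇ₜᵀ U̇ⱼ‖`. -/
def phi {M₁ m rs : ℕ} (Ud : Fin m → Matrix (Fin M₁) (Fin rs) ℝ) : ℝ :=
  ⨆ j : Fin m, ⨆ t : Fin m, if j ≠ t then spec ((Ud t)ᵀ * Ud j) else 0

/-- `z_{δ,x}`. -/
def zd (m n : ℕ) (δ x : ℝ) : ℝ :=
  1 + 2 * Real.sqrt (1 / x * Real.log (2 * n * m / δ)) + 2 / x * Real.log (2 * n * m / δ)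

/-- `η_{δ,x}`. -/
def etad (m n : ℕ) (δ x : ℝ) : ℝ :=
  max (4 * zd m n δ x / 3 * Real.log (2 * x * m / δ))
    (Real.sqrt (4 * n * (x + 3) / x ^ 2 * Real.log (2 * x * m / δ)))

/-- `σ_l(x/y, δ)`. -/
def sigl (M₂ : ℕ) (δ x y : ℝ) : ℝ :=
  (x - 2 * Real.sqrt (x * Real.log (2 * M₂ / δ))) /
    (y + 2 * Real.sqrt ((y - x) * Real.log (2 * M₂ / δ)) + 2 * Real.log (2 * M₂ / δ)
      - 2 * Real.sqrt (x * Real.log (2 * M₂ / δ)))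

/-- `σ_u(x/y, δ)`. -/
def sigu (M₂ : ℕ) (δ x y : ℝ) : ℝ :=
  (x + 2 * Real.sqrt (x * Real.log (2 * M₂ / δ)) + 2 * Real.log (2 * M₂ / δ)) /
    (y + 2 * Real.sqrt (x * Real.log (2 * M₂ / δ)) + 2 * Real.log (2 * M₂ / δ)
      - 2 * Real.sqrt ((y - x) * Real.log (2 * M₂ / δ)))

/-- `c_δ` of Theorems 3 and 8. -/
def cdel (M₁ m r s : ℕ) (δ : ℝ) : ℝ :=
  3 * max 1 (max (Real.sqrt (8 * M₁ * Real.pi / (((M₁ : ℝ) - 1) * ((r : ℝ) - s))))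
    (Real.sqrt (16 * M₁ * Real.log (m * r / δ) / (((M₁ : ℝ) - 1) * ((r : ℝ) - s)))))


/-- exponential, extended-nonnegative valued -/
def eexp (x : ℝ) : ENNReal := ENNReal.ofReal (Real.exp x)

lemma measurable_eexp : Measurable eexp := by
  unfold eexp; fun_prop

lemma eexp_add (x y : ℝ) : eexp (x + y) = eexp x * eexp y := by
  unfold eexp; rw [Real.exp_add, ENNReal.ofReal_mul (Real.exp_pos _).le]

lemma eexp_sum {ι : Type*} (s : Finset ι) (f : ι → ℝ) :
    eexp (∑ i ∈ s, f i) = ∏ i ∈ s, eexp (f i) := by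
  unfold eexp; rw [Real.exp_sum, ENNReal.ofReal_prod_of_nonneg (fun i _ => (Real.exp_pos _).le)]

abbrev gam : Measure ℝ := gaussianReal 0 1

lemma lintegral_pi_prod {n : ℕ} (f : Fin n → ℝ → ENNReal) (hf : ∀ i, Measurable (f i)) :
    ∫⁻ x : Fin n → ℝ, ∏ i, f i (x i) ∂(Measure.pi fun _ => gam) = ∏ i, ∫⁻ x, f i x ∂gam := by
  have h := lintegral_prod_eq_prod_lintegral_of_indepFun (μ := Measure.pi fun _ : Fin n => gam)
    Finset.univ (fun i x => f i (x i))
    (iIndepFun_pi (X := f) (fun i => (hf i).aemeasurable)) (fun i => by have := hf i; fun_prop)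
  rw [h]
  refine Finset.prod_congr rfl fun i _ => ?_
  exact (measurePreserving_eval (fun _ : Fin n => gam) i).lintegral_comp (hf i)

lemma gam_mgf (a : ℝ) : ∫⁻ x, eexp (a * x) ∂gam = eexp (a ^ 2 / 2) := by
  unfold eexp
  rw [← ofReal_integral_eq_lintegral_ofReal (integrable_exp_mul_gaussianReal a)
    (ae_of_all _ fun x => (Real.exp_pos _).le)]
  have := congrFun (mgf_fun_id_gaussianReal (μ := 0) (v := 1)) a
  simp only [mgf] at this
  rw [this]; simp

lemma gam_sq (a : ℝ) (ha : a < 1 / 2) :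
    ∫⁻ x, eexp (a * x ^ 2) ∂gam = ENNReal.ofReal (Real.sqrt (1 / (1 - 2 * a))) := by
  have h1 : 0 < 1 - 2 * a := by linarith
  set v : NNReal := ⟨1 / (1 - 2 * a), by positivity⟩ with hv
  have hv' : (v : ℝ) = 1 / (1 - 2 * a) := rfl
  have hv0 : v ≠ 0 := by
    intro h
    have : (v : ℝ) = 0 := by rw [h]; rfl
    rw [hv'] at this
    have h2 : 0 < 1 / (1 - 2 * a) := by positivity
    linarith
  rw [gam, gaussianReal_of_var_ne_zero _ one_ne_zero,
    lintegral_withDensity_eq_lintegral_mul _ (measurable_gaussianPDF _ _)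
      (by have := measurable_eexp; fun_prop)]
  have : ∀ x, (gaussianPDF 0 1 * fun x => eexp (a * x ^ 2)) x =
      ENNReal.ofReal (Real.sqrt (1 / (1 - 2 * a))) * gaussianPDF 0 v x := by
    intro x
    simp only [Pi.mul_apply, gaussianPDF, eexp]
    rw [← ENNReal.ofReal_mul (gaussianPDFReal_nonneg _ _ _), ← ENNReal.ofReal_mul (by positivity)]
    congr 1
    simp only [gaussianPDFReal, hv']
    rw [Real.sqrt_mul (by positivity) (1 / (1 - 2 * a)), NNReal.coe_one, mul_one, mul_assoc,
      ← Real.exp_add]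
    have hs : Real.sqrt (1 / (1 - 2 * a)) ≠ 0 := by positivity
    have hp : Real.sqrt (2 * Real.pi) ≠ 0 := by positivity
    have e : -(x - 0) ^ 2 / (2 * 1) + a * x ^ 2 = -(x - 0) ^ 2 / (2 * (1 / (1 - 2 * a))) := by
      field_simp; ring
    rw [e]; field_simp
  simp_rw [this]
  rw [lintegral_const_mul _ (measurable_gaussianPDF _ _), lintegral_gaussianPDF_eq_one _ hv0,
    mul_one]

lemma gam_sq_ge (a : ℝ) (ha : a < 1 / 2) : eexp a ≤ ∫⁻ x, eexp (a * x ^ 2) ∂gam := by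
  rw [gam_sq a ha]
  apply ENNReal.ofReal_le_ofReal
  apply Real.le_sqrt_of_sq_le
  have h1 : 0 < 1 - 2 * a := by linarith
  rw [le_div_iff₀ h1, ← Real.exp_nat_mul]
  have := Real.add_one_le_exp (-(2 * a))
  calc _ ≤ Real.exp ((2 : ℕ) * a) * Real.exp (-(2 * a)) := by gcongr; linarith
    _ = 1 := by rw [← Real.exp_add]; simp

lemma gam_sq_quarter : ∫⁻ x, eexp (1 / 4 * x ^ 2) ∂gam ≤ eexp (1 / 2) := by
  rw [gam_sq _ (by norm_num)]
  apply ENNReal.ofReal_le_ofReal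
  rw [Real.sqrt_le_left (Real.exp_pos _).le, ← Real.exp_nat_mul]
  have := Real.add_one_le_exp (1 : ℝ)
  norm_num at *; linarith

/-- Gaussian integral through orthonormal columns. -/
lemma gauss_cols {M r : ℕ} (V : Matrix (Fin M) (Fin r) ℝ) (hV : Vᵀ * V = 1) :
    ∫⁻ g : Fin M → ℝ, eexp (1 / 4 * ∑ j, ((Vᵀ *ᵥ g) j) ^ 2) ∂(Measure.pi fun _ => gam)
      ≤ eexp (r / 2) := by
  set c : ℝ := Real.sqrt (1 / 2) with hc
  have hc2 : c ^ 2 = 1 / 2 := Real.sq_sqrt (by norm_num)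
  have hme := measurable_eexp
  have h1 : ∀ g : Fin M → ℝ, eexp (1 / 4 * ∑ j, ((Vᵀ *ᵥ g) j) ^ 2) =
      ∫⁻ h : Fin r → ℝ, eexp (c * (h ⬝ᵥ (Vᵀ *ᵥ g))) ∂(Measure.pi fun _ => gam) := by
    intro g
    have : ∀ h : Fin r → ℝ, eexp (c * (h ⬝ᵥ (Vᵀ *ᵥ g))) =
        ∏ j, eexp ((c * (Vᵀ *ᵥ g) j) * h j) := by
      intro h
      rw [← eexp_sum, dotProduct, Finset.mul_sum]
      congr 1; exact Finset.sum_congr rfl fun j _ => by ring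
    simp_rw [this]
    rw [lintegral_pi_prod (fun j x => eexp ((c * (Vᵀ *ᵥ g) j) * x)) (fun j => by fun_prop)]
    simp_rw [gam_mgf]
    rw [← eexp_sum, Finset.mul_sum]
    congr 1; refine Finset.sum_congr rfl fun j _ => ?_
    rw [mul_pow, hc2]; ring
  have hm : Measurable (fun p : (Fin M → ℝ) × (Fin r → ℝ) => eexp (c * (p.2 ⬝ᵥ (Vᵀ *ᵥ p.1)))) := by
    apply hme.comp
    simp only [dotProduct, mulVec]
    fun_prop
  simp_rw [h1]
  rw [lintegral_lintegral_swap hm.aemeasurable]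
  have h2 : ∀ h : Fin r → ℝ,
      ∫⁻ g : Fin M → ℝ, eexp (c * (h ⬝ᵥ (Vᵀ *ᵥ g))) ∂(Measure.pi fun _ => gam) =
        ∏ j, eexp (1 / 4 * h j ^ 2) := by
    intro h
    have : ∀ g : Fin M → ℝ, eexp (c * (h ⬝ᵥ (Vᵀ *ᵥ g))) =
        ∏ j, eexp ((c * (V *ᵥ h) j) * g j) := by
      intro g
      rw [← eexp_sum, dotProduct_mulVec, vecMul_transpose, dotProduct, Finset.mul_sum]
      congr 1; exact Finset.sum_congr rfl fun j _ => by ring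
    simp_rw [this]
    rw [lintegral_pi_prod (fun j x => eexp ((c * (V *ᵥ h) j) * x)) (fun j => by fun_prop)]
    simp_rw [gam_mgf]
    rw [← eexp_sum, ← eexp_sum]
    congr 1
    have e : (V *ᵥ h) ⬝ᵥ (V *ᵥ h) = h ⬝ᵥ h := by
      rw [dotProduct_mulVec, ← mulVec_transpose, mulVec_mulVec, hV, one_mulVec]
    simp only [dotProduct] at e
    rw [← Finset.mul_sum]
    simp_rw [pow_two (h _), ← e, Finset.mul_sum]
    refine Finset.sum_congr rfl fun j _ => ?_
    rw [mul_pow, hc2]; ring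
  simp_rw [h2]
  rw [lintegral_pi_prod (fun j x => eexp (1 / 4 * x ^ 2)) (fun j => by fun_prop)]
  calc _ ≤ ∏ j : Fin r, eexp (1 / 2) := Finset.prod_le_prod' fun j _ => gam_sq_quarter
    _ = _ := by
      rw [← eexp_sum]; congr 1; simp; ring

lemma householder {M : ℕ} (a b : Fin M → ℝ) (h : a ⬝ᵥ a = b ⬝ᵥ b) :
    ∃ R ∈ Matrix.orthogonalGroup (Fin M) ℝ, R *ᵥ a = b := by
  by_cases hab : a = b
  · exact ⟨1, one_mem _, by simp [hab]⟩
  set u := a - b with hu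
  have hu0 : u ⬝ᵥ u ≠ 0 := by
    rw [Ne, dotProduct_self_eq_zero]; exact sub_ne_zero.2 hab
  have hua : u ⬝ᵥ u = 2 * (u ⬝ᵥ a) := by
    simp only [hu, sub_dotProduct, dotProduct_sub]
    rw [dotProduct_comm b a, h]; ring
  have hT : (1 - (2 / (u ⬝ᵥ u)) • vecMulVec u u)ᵀ = 1 - (2 / (u ⬝ᵥ u)) • vecMulVec u u := by
    simp [transpose_vecMulVec]
  refine ⟨1 - (2 / (u ⬝ᵥ u)) • vecMulVec u u, ?_, ?_⟩
  · rw [Matrix.mem_orthogonalGroup_iff, hT]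
    have e : vecMulVec u u * vecMulVec u u = (u ⬝ᵥ u) • vecMulVec u u := by
      rw [vecMulVec_mul_vecMulVec, vecMulVec_smul]
    rw [sub_mul, mul_sub, mul_sub, one_mul, one_mul, mul_one, smul_mul_assoc, mul_smul_comm, e,
      smul_smul, smul_smul]
    have : 2 / (u ⬝ᵥ u) * (2 / (u ⬝ᵥ u)) * (u ⬝ᵥ u) = 2 / (u ⬝ᵥ u) + 2 / (u ⬝ᵥ u) := by
      field_simp; ring
    rw [this, add_smul]; abel
  · rw [sub_mulVec, one_mulVec, smul_mulVec, vecMulVec_mulVec]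
    ext i
    simp only [Pi.sub_apply, Pi.smul_apply, smul_eq_mul, op_smul_eq_smul]
    rw [hua] at hu0 ⊢
    have : u ⬝ᵥ a ≠ 0 := fun h => hu0 (by rw [h]; simp)
    field_simp
    simp [hu]

lemma bessel {M r : ℕ} (W : Matrix (Fin M) (Fin r) ℝ) (hW : Wᵀ * W = 1) (y : Fin M → ℝ) :
    ∑ j, ((Wᵀ *ᵥ y) j) ^ 2 ≤ y ⬝ᵥ y := by
  have h0 : 0 ≤ (y - W *ᵥ (Wᵀ *ᵥ y)) ⬝ᵥ (y - W *ᵥ (Wᵀ *ᵥ y)) :=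
    Finset.sum_nonneg fun i _ => mul_self_nonneg _
  have e1 : y ⬝ᵥ (W *ᵥ (Wᵀ *ᵥ y)) = (Wᵀ *ᵥ y) ⬝ᵥ (Wᵀ *ᵥ y) := by
    rw [dotProduct_mulVec, ← mulVec_transpose]
  have e2 : (W *ᵥ (Wᵀ *ᵥ y)) ⬝ᵥ (W *ᵥ (Wᵀ *ᵥ y)) = (Wᵀ *ᵥ y) ⬝ᵥ (Wᵀ *ᵥ y) := by
    rw [dotProduct_mulVec, ← mulVec_transpose, mulVec_mulVec, hW, one_mulVec]
  rw [sub_dotProduct, dotProduct_sub, dotProduct_sub, e2,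
    dotProduct_comm (W *ᵥ (Wᵀ *ᵥ y)) y, e1] at h0
  have e3 : ∑ j, ((Wᵀ *ᵥ y) j) ^ 2 = (Wᵀ *ᵥ y) ⬝ᵥ (Wᵀ *ᵥ y) := by
    simp [dotProduct, pow_two]
  linarith

lemma measurable_entry {m n : Type*} (i : m) (j : n) :
    Measurable (fun A : Matrix m n ℝ => A i j) :=
  (measurable_pi_apply j).comp (measurable_pi_apply i)

lemma measurable_of_entries {α m n : Type*} [MeasurableSpace α] {F : α → Matrix m n ℝ}
    (h : ∀ i j, Measurable fun a => F a i j) : Measurable F :=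
  measurable_pi_lambda _ fun i => measurable_pi_lambda _ fun j => h i j

lemma orth_mul {M : ℕ} {R : Matrix (Fin M) (Fin M) ℝ} (hR : R ∈ Matrix.orthogonalGroup (Fin M) ℝ) :
    Rᵀ * R = 1 := (Matrix.mem_orthogonalGroup_iff' _ _).1 hR

lemma orth_mul' {M : ℕ} {R : Matrix (Fin M) (Fin M) ℝ} (hR : R ∈ Matrix.orthogonalGroup (Fin M) ℝ) :
    R * Rᵀ = 1 := (Matrix.mem_orthogonalGroup_iff _ _).1 hR

lemma orth_transpose {M : ℕ} {R : Matrix (Fin M) (Fin M) ℝ}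
    (hR : R ∈ Matrix.orthogonalGroup (Fin M) ℝ) : Rᵀ ∈ Matrix.orthogonalGroup (Fin M) ℝ := by
  rw [Matrix.mem_orthogonalGroup_iff, transpose_transpose]
  exact orth_mul hR

lemma haar_inv {Ω : Type} [MeasurableSpace Ω] {Pr : Measure Ω} {M : ℕ}
    {Q : Ω → Matrix (Fin M) (Fin M) ℝ} (hQ : Measurable Q)
    (hQh : ∀ R ∈ Matrix.orthogonalGroup (Fin M) ℝ,
      Measure.map (fun ω => R * Q ω) Pr = Measure.map Q Pr)
    (F : Matrix (Fin M) (Fin M) ℝ → ENNReal) (hF : Measurable F)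
    (R : Matrix (Fin M) (Fin M) ℝ) (hR : R ∈ Matrix.orthogonalGroup (Fin M) ℝ) :
    ∫⁻ ω, F (R * Q ω) ∂Pr = ∫⁻ ω, F (Q ω) ∂Pr := by
  have hRm : Measurable fun ω => R * Q ω := by
    apply measurable_of_entries
    intro i j
    simp only [Matrix.mul_apply]
    exact Finset.measurable_sum _ fun k _ => ((measurable_entry k j).comp hQ).const_mul _
  rw [← lintegral_map hF hRm, hQh R hR, lintegral_map hF hQ]

lemma haar_mgf {Ω : Type} [MeasurableSpace Ω] {Pr : Measure Ω} [IsProbabilityMeasure Pr] {M r : ℕ}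
    {Q : Ω → Matrix (Fin M) (Fin M) ℝ} (hQ : Measurable Q)
    (hQo : ∀ ω, Q ω ∈ Matrix.orthogonalGroup (Fin M) ℝ)
    (hQh : ∀ R ∈ Matrix.orthogonalGroup (Fin M) ℝ,
      Measure.map (fun ω => R * Q ω) Pr = Measure.map Q Pr)
    (W : Matrix (Fin M) (Fin r) ℝ) (hW : Wᵀ * W = 1) (w : Fin M → ℝ) (hw : w ⬝ᵥ w = 1) :
    ∫⁻ ω, eexp (M / 4 * ∑ j, ((Wᵀ *ᵥ ((Q ω)ᵀ *ᵥ w)) j) ^ 2) ∂Pr ≤ eexp (r / 2) := by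
  have hme := measurable_eexp
  have hent : ∀ i j, Measurable fun ω => Q ω i j := fun i j => (measurable_entry i j).comp hQ
  -- lower bound by Gaussian average
  have h1 : ∀ ω, eexp (M / 4 * ∑ j, ((Wᵀ *ᵥ ((Q ω)ᵀ *ᵥ w)) j) ^ 2) ≤
      ∫⁻ g : Fin M → ℝ, eexp (1 / 4 * ((g ⬝ᵥ g) * ∑ j, ((Wᵀ *ᵥ ((Q ω)ᵀ *ᵥ w)) j) ^ 2))
        ∂(Measure.pi fun _ => gam) := by
    intro ω
    set z := ∑ j, ((Wᵀ *ᵥ ((Q ω)ᵀ *ᵥ w)) j) ^ 2 with hz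
    have hz1 : z ≤ 1 := by
      refine (bessel W hW _).trans_eq ?_
      rw [dotProduct_mulVec, ← mulVec_transpose, mulVec_mulVec, transpose_transpose,
        orth_mul' (hQo ω), one_mulVec, hw]
    have : ∀ g : Fin M → ℝ, eexp (1 / 4 * ((g ⬝ᵥ g) * z)) = ∏ k, eexp ((z / 4) * g k ^ 2) := by
      intro g
      rw [← eexp_sum, dotProduct, Finset.sum_mul, Finset.mul_sum]
      congr 1; exact Finset.sum_congr rfl fun j _ => by ring
    simp_rw [this]
    rw [lintegral_pi_prod (fun j x => eexp (z / 4 * x ^ 2)) (fun j => by fun_prop)]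
    calc _ = ∏ k : Fin M, eexp (z / 4) := by
          rw [← eexp_sum]; congr 1; simp; ring
      _ ≤ _ := Finset.prod_le_prod' fun j _ => gam_sq_ge _ (by linarith)
  refine (lintegral_mono h1).trans ?_
  rw [lintegral_lintegral_swap]
  swap
  · apply Measurable.aemeasurable
    apply hme.comp
    simp only [dotProduct, mulVec, transpose_apply]
    fun_prop
  -- replace the fixed direction by `g`
  have h2 : ∀ g : Fin M → ℝ,
      ∫⁻ ω, eexp (1 / 4 * ((g ⬝ᵥ g) * ∑ j, ((Wᵀ *ᵥ ((Q ω)ᵀ *ᵥ w)) j) ^ 2)) ∂Pr =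
      ∫⁻ ω, eexp (1 / 4 * ∑ j, (((Q ω * W)ᵀ *ᵥ g) j) ^ 2) ∂Pr := by
    intro g
    have hgg : 0 ≤ g ⬝ᵥ g := Finset.sum_nonneg fun i _ => mul_self_nonneg _
    set s := Real.sqrt (g ⬝ᵥ g) with hs
    have hs2 : s * s = g ⬝ᵥ g := Real.mul_self_sqrt hgg
    obtain ⟨R, hR, hRg⟩ := householder (s • w) g (by
      rw [smul_dotProduct, dotProduct_smul, hw]; simp [hs2])
    rw [← haar_inv hQ hQh (fun A => eexp (1 / 4 * ∑ j, (((A * W)ᵀ *ᵥ g) j) ^ 2)) _ R hR]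
    · refine lintegral_congr fun ω => ?_
      congr 2
      rw [Finset.mul_sum]
      refine Finset.sum_congr rfl fun j _ => ?_
      have : ((R * Q ω * W)ᵀ *ᵥ g) = s • (Wᵀ *ᵥ ((Q ω)ᵀ *ᵥ w)) := by
        rw [← hRg, mulVec_mulVec, Matrix.mul_assoc R, transpose_mul R,
          Matrix.mul_assoc, orth_mul hR, Matrix.mul_one,
          transpose_mul, mulVec_smul, mulVec_mulVec]
      rw [this, ← hs2]; simp; ring
    · apply hme.comp
      simp only [dotProduct, mulVec, transpose_apply, Matrix.mul_apply]
      have := fun i j => measurable_entry (m := Fin M) (n := Fin M) i j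
      fun_prop
  simp_rw [h2]
  rw [lintegral_lintegral_swap]
  swap
  · apply Measurable.aemeasurable
    apply hme.comp
    simp only [dotProduct, mulVec, transpose_apply, Matrix.mul_apply]
    fun_prop
  calc _ ≤ ∫⁻ ω, eexp (r / 2) ∂Pr := by
        refine lintegral_mono fun ω => gauss_cols _ ?_
        rw [transpose_mul, Matrix.mul_assoc, ← Matrix.mul_assoc (Q ω)ᵀ, orth_mul (hQo ω),
          Matrix.one_mul, hW]
    _ = _ := by simp

lemma spec_le {a b : ℕ} (A : Matrix (Fin a) (Fin b) ℝ) :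
    spec A ≤ Real.sqrt (∑ i, ∑ j, (A i j) ^ 2) := by
  apply Real.iSup_le _ (Real.sqrt_nonneg _)
  rintro ⟨v, hv⟩
  have hv1 : ∑ j, v j ^ 2 = 1 := by
    unfold enorm at hv
    rwa [Real.sqrt_eq_one] at hv
  apply Real.sqrt_le_sqrt
  refine Finset.sum_le_sum fun i _ => ?_
  have := Finset.sum_mul_sq_le_sq_mul_sq Finset.univ (A i) v
  rw [hv1, mul_one] at this
  exact this

lemma frob {M r : ℕ} (A B : Matrix (Fin M) (Fin r) ℝ) :
    ∑ i, ∑ j, ((Aᵀ * B) i j) ^ 2 = ((A * Aᵀ) * (B * Bᵀ)).trace := by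
  have h : ((A * Aᵀ) * (B * Bᵀ)).trace = ((Aᵀ * B) * (Aᵀ * B)ᵀ).trace := by
    rw [Matrix.mul_assoc A, Matrix.trace_mul_comm A, transpose_mul, transpose_transpose]
    simp only [Matrix.mul_assoc]
  rw [h, Matrix.trace]
  refine Finset.sum_congr rfl fun i _ => ?_
  rw [diag_apply, Matrix.mul_apply]
  refine Finset.sum_congr rfl fun j _ => ?_
  rw [transpose_apply, pow_two]

lemma colSpan_eq_range {M r : ℕ} (A : Matrix (Fin M) (Fin r) ℝ) :
    colSpan A = LinearMap.range A.mulVecLin := by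
  rw [Matrix.range_mulVecLin]; rfl

lemma colSpan_mul {M r : ℕ} (Q : Matrix (Fin M) (Fin M) ℝ) (A : Matrix (Fin M) (Fin r) ℝ) :
    colSpan (Q * A) = (colSpan A).map Q.mulVecLin := by
  rw [colSpan_eq_range, colSpan_eq_range, Matrix.mulVecLin_mul, LinearMap.range_comp]

lemma proj_mul {M r : ℕ} (A B : Matrix (Fin M) (Fin r) ℝ) (hA : Aᵀ * A = 1)
    (h : colSpan A = colSpan B) : A * Aᵀ * B = B := by
  ext i j
  have hj : Bᵀ j ∈ colSpan A := by
    rw [h]; exact Submodule.subset_span ⟨j, rfl⟩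
  rw [colSpan_eq_range] at hj
  obtain ⟨c, hc⟩ := hj
  rw [mulVecLin_apply] at hc
  have : (A * Aᵀ) *ᵥ Bᵀ j = Bᵀ j := by
    rw [← hc, mulVec_mulVec, Matrix.mul_assoc, hA, Matrix.mul_one]
  exact congrFun this i

lemma proj_eq {M r : ℕ} (A B : Matrix (Fin M) (Fin r) ℝ) (hA : Aᵀ * A = 1) (hB : Bᵀ * B = 1)
    (h : colSpan A = colSpan B) : A * Aᵀ = B * Bᵀ := by
  have h1 : (A * Aᵀ) * (B * Bᵀ) = B * Bᵀ := by
    rw [← Matrix.mul_assoc, proj_mul A B hA h]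
  have h2 : (B * Bᵀ) * (A * Aᵀ) = A * Aᵀ := by
    rw [← Matrix.mul_assoc, proj_mul B A hB h.symm]
  have h3 := congrArg transpose h1
  simp only [transpose_mul, transpose_transpose] at h3
  rw [← h2, h3]

lemma indep_mgf {Ω : Type} [MeasurableSpace Ω] {Pr : Measure Ω} [IsProbabilityMeasure Pr] {M r : ℕ}
    {Q₁ Q₂ : Ω → Matrix (Fin M) (Fin M) ℝ} (hQ₁ : Measurable Q₁) (hQ₂ : Measurable Q₂)
    (hQ₁o : ∀ ω, Q₁ ω ∈ Matrix.orthogonalGroup (Fin M) ℝ)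
    (hQ₂o : ∀ ω, Q₂ ω ∈ Matrix.orthogonalGroup (Fin M) ℝ)
    (hQ₂h : ∀ R ∈ Matrix.orthogonalGroup (Fin M) ℝ,
      Measure.map (fun ω => R * Q₂ ω) Pr = Measure.map Q₂ Pr)
    (hind : IndepFun Q₁ Q₂ Pr)
    (W : Matrix (Fin M) (Fin r) ℝ) (hW : Wᵀ * W = 1) (w : Fin M → ℝ) (hw : w ⬝ᵥ w = 1) :
    ∫⁻ ω, eexp (M / 4 * ∑ j, ((Wᵀ *ᵥ (((Q₁ ω)ᵀ * Q₂ ω)ᵀ *ᵥ w)) j) ^ 2) ∂Pr ≤ eexp (r / 2) := by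
  let G : Matrix (Fin M) (Fin M) ℝ → ENNReal := fun A =>
    eexp (M / 4 * ∑ j, ((Wᵀ *ᵥ (Aᵀ *ᵥ w)) j) ^ 2)
  have hent := fun i j => measurable_entry (m := Fin M) (n := Fin M) i j
  have hG : Measurable G := by
    apply measurable_eexp.comp
    simp only [dotProduct, mulVec, transpose_apply]
    fun_prop
  have hmul : Measurable fun p : Matrix (Fin M) (Fin M) ℝ × Matrix (Fin M) (Fin M) ℝ =>
      p.1ᵀ * p.2 := by
    apply measurable_of_entries
    intro i j
    simp only [Matrix.mul_apply, transpose_apply]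
    exact Finset.measurable_sum _ fun k _ =>
      ((hent k i).comp measurable_fst).mul ((hent k j).comp measurable_snd)
  have hGm := hG.comp hmul
  have hmap := (indepFun_iff_map_prod_eq_prod_map_map hQ₁.aemeasurable hQ₂.aemeasurable).1 hind
  have := Measure.isProbabilityMeasure_map (μ := Pr) hQ₁.aemeasurable
  have := Measure.isProbabilityMeasure_map (μ := Pr) hQ₂.aemeasurable
  calc ∫⁻ ω, G ((Q₁ ω)ᵀ * Q₂ ω) ∂Pr
      = ∫⁻ p, G (p.1ᵀ * p.2) ∂(Measure.map (fun ω => (Q₁ ω, Q₂ ω)) Pr) :=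
        (lintegral_map hGm (hQ₁.prodMk hQ₂)).symm
    _ = ∫⁻ A, ∫⁻ B, G (Aᵀ * B) ∂(Measure.map Q₂ Pr) ∂(Measure.map Q₁ Pr) := by
        rw [hmap]; exact lintegral_prod _ hGm.aemeasurable
    _ = ∫⁻ ω, ∫⁻ B, G ((Q₁ ω)ᵀ * B) ∂(Measure.map Q₂ Pr) ∂Pr :=
        lintegral_map hGm.lintegral_prod_right' hQ₁
    _ = ∫⁻ ω, ∫⁻ ω', G (Q₂ ω') ∂Pr ∂Pr := by
        refine lintegral_congr fun ω => ?_
        refine (lintegral_map (hGm.comp (measurable_prodMk_left (x := Q₁ ω))) hQ₂).trans ?_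
        exact haar_inv hQ₂ hQ₂h G hG _ (orth_transpose (hQ₁o ω))
    _ = ∫⁻ ω', G (Q₂ ω') ∂Pr := by simp
    _ ≤ _ := haar_mgf hQ₂ hQ₂o hQ₂h W hW w hw

/-- Lemma 3: spectral-norm bound for the interaction of two independent
uniformly random `r`-dimensional subspaces of `ℝ^{M₁}`.  A uniformly random subspace is
realized as the image of a fixed subspace `E₀` under a Haar-distributed orthogonal matrix,
Haar-distributedness being expressed by rotation invariance of the law. -/
theorem statement10 (Ω : Type) [MeasurableSpace Ω] (Pr : Measure Ω) [IsProbabilityMeasure Pr]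
    (M₁ r : ℕ)
    (Q₁ Q₂ : Ω → Matrix (Fin M₁) (Fin M₁) ℝ)
    (hQ₁meas : Measurable Q₁) (hQ₂meas : Measurable Q₂)
    (hQ₁orth : ∀ ω, Q₁ ω ∈ Matrix.orthogonalGroup (Fin M₁) ℝ)
    (hQ₂orth : ∀ ω, Q₂ ω ∈ Matrix.orthogonalGroup (Fin M₁) ℝ)
    (hQ₁haar : ∀ R ∈ Matrix.orthogonalGroup (Fin M₁) ℝ,
      Measure.map (fun ω => R * Q₁ ω) Pr = Measure.map Q₁ Pr)
    (hQ₂haar : ∀ R ∈ Matrix.orthogonalGroup (Fin M₁) ℝ,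
      Measure.map (fun ω => R * Q₂ ω) Pr = Measure.map Q₂ Pr)
    (hQindep : IndepFun Q₁ Q₂ Pr)
    (E₀ : Submodule ℝ (Fin M₁ → ℝ)) (hE₀ : Module.finrank ℝ E₀ = r)
    (U₁ U₂ : Ω → Matrix (Fin M₁) (Fin r) ℝ)
    (hU₁meas : Measurable U₁) (hU₂meas : Measurable U₂)
    (hU₁o : ∀ ω, (U₁ ω)ᵀ * U₁ ω = 1) (hU₂o : ∀ ω, (U₂ ω)ᵀ * U₂ ω = 1)
    (hU₁span : ∀ ω, colSpan (U₁ ω) = E₀.map (Matrix.mulVecLin (Q₁ ω)))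
    (hU₂span : ∀ ω, colSpan (U₂ ω) = E₀.map (Matrix.mulVecLin (Q₂ ω)))
    (δ : ℝ) (hδ : δ ∈ Set.Ioo (0 : ℝ) 1) :
    Pr {ω | Real.sqrt (
        (3 * max 1 (max (Real.sqrt (8 * M₁ * Real.pi / (((M₁ : ℝ) - 1) * r)))
            (Real.sqrt (8 * M₁ * Real.log (r / δ) / (((M₁ : ℝ) - 1) * r))))) ^ 2
          * (r : ℝ) ^ 2 / M₁)
        < spec ((U₁ ω)ᵀ * U₂ ω)} ≤ ENNReal.ofReal δ := by
  obtain ⟨hδ0, hδ1⟩ := hδ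
  obtain ⟨ω₀⟩ : Nonempty Ω := Pr.nonempty_of_neZero
  set C : ℝ := 3 * max 1 (max (Real.sqrt (8 * M₁ * Real.pi / (((M₁ : ℝ) - 1) * r)))
            (Real.sqrt (8 * M₁ * Real.log (r / δ) / (((M₁ : ℝ) - 1) * r)))) with hC
  -- orthonormal basis of `E₀`
  set W : Matrix (Fin M₁) (Fin r) ℝ := (Q₁ ω₀)ᵀ * U₁ ω₀ with hWdef
  have hW : Wᵀ * W = 1 := by
    rw [hWdef, transpose_mul, transpose_transpose, Matrix.mul_assoc, ← Matrix.mul_assoc (Q₁ ω₀),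
      orth_mul' (hQ₁orth ω₀), Matrix.one_mul, hU₁o]
  have hWspan : colSpan W = E₀ := by
    rw [hWdef, colSpan_mul, hU₁span, ← Submodule.map_comp, ← Matrix.mulVecLin_mul,
      orth_mul (hQ₁orth ω₀), Matrix.mulVecLin_one, Submodule.map_id]
  have hQW : ∀ Q ∈ Matrix.orthogonalGroup (Fin M₁) ℝ, (Q * W)ᵀ * (Q * W) = 1 := by
    intro Q hQ
    rw [transpose_mul, Matrix.mul_assoc, ← Matrix.mul_assoc Qᵀ, orth_mul hQ, Matrix.one_mul, hW]
  have hP₁ : ∀ ω, U₁ ω * (U₁ ω)ᵀ = (Q₁ ω * W) * (Q₁ ω * W)ᵀ := fun ω =>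
    proj_eq _ _ (hU₁o ω) (hQW _ (hQ₁orth ω)) (by rw [colSpan_mul, hWspan, hU₁span])
  have hP₂ : ∀ ω, U₂ ω * (U₂ ω)ᵀ = (Q₂ ω * W) * (Q₂ ω * W)ᵀ := fun ω =>
    proj_eq _ _ (hU₂o ω) (hQW _ (hQ₂orth ω)) (by rw [colSpan_mul, hWspan, hU₂span])
  let Z : Fin r → Ω → ℝ := fun i ω => ∑ j, ((Wᵀ *ᵥ (((Q₁ ω)ᵀ * Q₂ ω)ᵀ *ᵥ Wᵀ i)) j) ^ 2
  have hspec : ∀ ω, spec ((U₁ ω)ᵀ * U₂ ω) ≤ Real.sqrt (∑ i, Z i ω) := by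
    intro ω
    refine (spec_le _).trans_eq ?_
    rw [frob, hP₁, hP₂, ← frob]
    congr 1
    refine Finset.sum_congr rfl fun i _ => Finset.sum_congr rfl fun j _ => ?_
    congr 1
    have : (Q₁ ω * W)ᵀ * (Q₂ ω * W) = (Wᵀ * (((Q₁ ω)ᵀ * Q₂ ω)ᵀ * W))ᵀ := by
      simp only [transpose_mul, transpose_transpose, Matrix.mul_assoc]
    rw [this, transpose_apply, mulVec_mulVec, ← Matrix.mul_assoc]
    simp only [Matrix.mul_apply, mulVec, dotProduct, transpose_apply]
  have hw : ∀ i, Wᵀ i ⬝ᵥ Wᵀ i = 1 := by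
    intro i
    have := congrFun (congrFun hW i) i
    simpa [Matrix.mul_apply, dotProduct] using this
  have hZ1 : ∀ i ω, Z i ω ≤ 1 := by
    intro i ω
    refine (bessel W hW _).trans_eq ?_
    have ho : (Q₁ ω)ᵀ * Q₂ ω ∈ Matrix.orthogonalGroup (Fin M₁) ℝ :=
      mul_mem (orth_transpose (hQ₁orth ω)) (hQ₂orth ω)
    rw [dotProduct_mulVec, ← mulVec_transpose, mulVec_mulVec, transpose_transpose,
        orth_mul' ho, one_mulVec, hw]
  rcases Nat.eq_zero_or_pos r with hr | hr
  · subst hr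
    have : ∀ ω, ¬ (Real.sqrt (C ^ 2 * ((0 : ℕ) : ℝ) ^ 2 / M₁) < spec ((U₁ ω)ᵀ * U₂ ω)) := by
      intro ω h
      have := h.trans_le (hspec ω)
      simp at this
    simp only [this, Set.setOf_false, measure_empty, zero_le]
  have hrM : r ≤ M₁ := by
    have := Submodule.finrank_le E₀
    rw [hE₀] at this; simpa using this
  have hr' : (1 : ℝ) ≤ r := by exact_mod_cast hr
  have hM' : (1 : ℝ) ≤ M₁ := by exact_mod_cast (hr.trans_le hrM : 0 < M₁)
  set s : ℝ := C ^ 2 * r / M₁ with hs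
  have hC3 : 3 ≤ C := by
    have := le_max_left 1 (max (Real.sqrt (8 * M₁ * Real.pi / (((M₁ : ℝ) - 1) * r)))
            (Real.sqrt (8 * M₁ * Real.log (r / δ) / (((M₁ : ℝ) - 1) * r))))
    rw [hC]; linarith
  have hMs : M₁ * s = C ^ 2 * r := by rw [hs]; field_simp
  have hC9 : 9 * (r : ℝ) ≤ C ^ 2 * r := by
    have : 9 ≤ C ^ 2 := by nlinarith
    gcongr
  have hsub : {ω | Real.sqrt (C ^ 2 * (r : ℝ) ^ 2 / M₁) < spec ((U₁ ω)ᵀ * U₂ ω)} ⊆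
      ⋃ i : Fin r, {ω | s < Z i ω} := by
    intro ω hω
    have h := lt_of_lt_of_le hω (hspec ω)
    have h2 : C ^ 2 * (r : ℝ) ^ 2 / M₁ < ∑ i, Z i ω := (Real.sqrt_lt_sqrt_iff (by positivity)).1 h
    by_contra hcon
    simp only [Set.mem_iUnion, Set.mem_ofPred_eq, not_exists, not_lt] at hcon
    have h3 : ∑ i, Z i ω ≤ ∑ i : Fin r, s := Finset.sum_le_sum fun i _ => hcon i
    simp only [Finset.sum_const, Finset.card_univ, Fintype.card_fin, nsmul_eq_mul] at h3
    have : (r : ℝ) * s = C ^ 2 * (r : ℝ) ^ 2 / M₁ := by rw [hs]; ring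
    linarith
  have hZ : ∀ i, Pr {ω | s < Z i ω} ≤ ENNReal.ofReal (δ / r) := by
    intro i
    by_cases hM1 : M₁ = 1
    · have : ∀ ω, ¬ s < Z i ω := by
        intro ω h
        have h1 := hZ1 i ω
        rw [hM1] at hMs
        push_cast at hMs
        nlinarith
      simp [this]
    have hM2 : (2 : ℝ) ≤ M₁ := by
      have : 2 ≤ M₁ := by omega
      exact_mod_cast this
    have hL : 0 ≤ Real.log (r / δ) := by
      apply Real.log_nonneg
      rw [le_div_iff₀ hδ0]; linarith
    have hCL : 72 * Real.log (r / δ) ≤ C ^ 2 * r := by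
      have h1 : Real.sqrt (8 * M₁ * Real.log (r / δ) / (((M₁ : ℝ) - 1) * r)) ≤ C / 3 := by
        have : C / 3 = max 1 (max (Real.sqrt (8 * M₁ * Real.pi / (((M₁ : ℝ) - 1) * r)))
            (Real.sqrt (8 * M₁ * Real.log (r / δ) / (((M₁ : ℝ) - 1) * r)))) := by rw [hC]; ring
        rw [this]
        exact (le_max_right _ _).trans (le_max_right _ _)
      have h2 := (Real.sqrt_le_left (by linarith)).1 h1
      have hpos : 0 < ((M₁ : ℝ) - 1) * r := mul_pos (by linarith) (by linarith)
      rw [div_le_iff₀ hpos] at h2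
      have h3 : 72 * Real.log (r / δ) * ((M₁ : ℝ) - 1) ≤ (C ^ 2 * r) * ((M₁ : ℝ) - 1) := by
        nlinarith
      exact le_of_mul_le_mul_right h3 (by linarith)
    have hkey : (r : ℝ) / 2 + Real.log (r / δ) ≤ M₁ / 4 * s := by
      have : (M₁ : ℝ) / 4 * s = C ^ 2 * r / 4 := by rw [← hMs]; ring
      rw [this]; linarith
    have hE := indep_mgf hQ₁meas hQ₂meas hQ₁orth hQ₂orth hQ₂haar hQindep W hW (Wᵀ i) (hw i)
    have hmeas : Measurable (Z i) := by
      have h1 : ∀ i j, Measurable fun ω => Q₁ ω i j := fun i j =>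
        (measurable_entry i j).comp hQ₁meas
      have h2 : ∀ i j, Measurable fun ω => Q₂ ω i j := fun i j =>
        (measurable_entry i j).comp hQ₂meas
      simp only [Z, dotProduct, mulVec, transpose_apply, Matrix.mul_apply]
      fun_prop
    have hmk := mul_meas_ge_le_lintegral₀ (μ := Pr) (f := fun ω => eexp (M₁ / 4 * Z i ω))
      (measurable_eexp.comp (hmeas.const_mul _)).aemeasurable (eexp (M₁ / 4 * s))
    have hsub2 : {ω | s < Z i ω} ⊆ {ω | eexp (M₁ / 4 * s) ≤ eexp (M₁ / 4 * Z i ω)} := by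
      intro ω hω
      apply ENNReal.ofReal_le_ofReal
      apply Real.exp_le_exp.2
      have : s < Z i ω := hω
      gcongr
    have h4 : eexp (r / 2) * (eexp (Real.log (r / δ)) * Pr {ω | s < Z i ω}) ≤ eexp (r / 2) * 1 := by
      rw [← mul_assoc, ← eexp_add, mul_one]
      calc _ ≤ eexp (M₁ / 4 * s) * Pr {ω | eexp (M₁ / 4 * s) ≤ eexp (M₁ / 4 * Z i ω)} := by
            gcongr
            exact ENNReal.ofReal_le_ofReal (Real.exp_le_exp.2 hkey)
        _ ≤ _ := hmk
        _ ≤ _ := hE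
    have h5 : eexp (Real.log (r / δ)) * Pr {ω | s < Z i ω} ≤ 1 := by
      refine (ENNReal.mul_le_mul_iff_right ?_ ?_).1 h4
      · simp [eexp, Real.exp_pos]
      · simp [eexp]
    have h6 : eexp (Real.log (r / δ)) = ENNReal.ofReal (r / δ) := by
      rw [eexp, Real.exp_log (by positivity)]
    rw [h6] at h5
    have h7 : ENNReal.ofReal (δ / r) = (ENNReal.ofReal (r / δ))⁻¹ := by
      rw [← ENNReal.ofReal_inv_of_pos (by positivity), inv_div]
    rw [h7, ENNReal.le_inv_iff_mul_le, mul_comm]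
    exact h5
  calc _ ≤ Pr (⋃ i : Fin r, {ω | s < Z i ω}) := measure_mono hsub
    _ ≤ ∑ i : Fin r, Pr {ω | s < Z i ω} := measure_iUnion_fintype_le _ _
    _ ≤ ∑ i : Fin r, ENNReal.ofReal (δ / r) := Finset.sum_le_sum fun i _ => hZ i
    _ = ENNReal.ofReal δ := by
      rw [Finset.sum_const, Finset.card_univ, Fintype.card_fin, nsmul_eq_mul,
        ← ENNReal.ofReal_natCast, ← ENNReal.ofReal_mul (by positivity)]
      congr 1; field_simp

end Paper
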